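/- For every s with 0 < s < 1/2 there exist constants c_s, C_s > 0 such that for all κ > 0 and all ξ ∈ ℝ, c_s·ξ²·(κ²+ξ²)^{s−1} ≤ ∫_κ^∞ ϰ^{2s−1}·ξ²/(4ϰ²+ξ²) dϰ ≤ C_s·ξ²·(κ²+ξ²)^{s−1}. -/

import Mathlib

open MeasureTheory

/-- Multiplying by `t ^ (2 * s - 1)` the bound `1 / t ^ 2` gives the power `2 * s - 3`. -/
lemma rpow_two_mul_sub_one_div_sq (s : ℝ) {t : ℝ} (ht : 0 < t) :
    t ^ (2 * s - 1) / t ^ 2 = t ^ (2 * s - 3) := by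
  rw [← Real.rpow_natCast t 2, ← Real.rpow_sub ht]
  congr 1
  push_cast
  ring

lemma weight_le_tail (s ξ : ℝ) {t : ℝ} (ht : 0 < t) :
    t ^ (2 * s - 1) * ξ ^ 2 / (4 * t ^ 2 + ξ ^ 2) ≤ ξ ^ 2 / 4 * t ^ (2 * s - 3) := by
  rw [← rpow_two_mul_sub_one_div_sq s ht]
  have h := Real.rpow_nonneg ht.le (2 * s - 1)
  calc t ^ (2 * s - 1) * ξ ^ 2 / (4 * t ^ 2 + ξ ^ 2)
      ≤ t ^ (2 * s - 1) * ξ ^ 2 / (4 * t ^ 2) := by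
        gcongr
        nlinarith [sq_nonneg ξ]
    _ = _ := by field_simp

lemma tail_le_weight (s ξ : ℝ) {t : ℝ} (ht : 0 < t) (hξ : ξ ^ 2 ≤ t ^ 2) :
    ξ ^ 2 / 5 * t ^ (2 * s - 3) ≤ t ^ (2 * s - 1) * ξ ^ 2 / (4 * t ^ 2 + ξ ^ 2) := by
  rw [← rpow_two_mul_sub_one_div_sq s ht]
  have h := Real.rpow_nonneg ht.le (2 * s - 1)
  calc ξ ^ 2 / 5 * (t ^ (2 * s - 1) / t ^ 2) = t ^ (2 * s - 1) * ξ ^ 2 / (5 * t ^ 2) := by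
        field_simp
    _ ≤ _ := by
        gcongr
        linarith

lemma integrableOn_weight {s : ℝ} (hs : s < 1) (ξ : ℝ) {κ : ℝ} (hκ : 0 < κ) :
    IntegrableOn (fun t : ℝ => t ^ (2 * s - 1) * ξ ^ 2 / (4 * t ^ 2 + ξ ^ 2)) (Set.Ioi κ) := by
  have hg : IntegrableOn (fun t : ℝ => ξ ^ 2 / 4 * t ^ (2 * s - 3)) (Set.Ioi κ) :=
    (integrableOn_Ioi_rpow_of_lt (by linarith) hκ).const_mul _
  refine Integrable.mono' hg (Measurable.aestronglyMeasurable (by fun_prop)) ?_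
  filter_upwards [ae_restrict_mem measurableSet_Ioi] with t ht
  have ht0 : 0 < t := hκ.trans ht
  have h := Real.rpow_nonneg ht0.le (2 * s - 1)
  rw [Real.norm_of_nonneg (by positivity)]
  exact weight_le_tail s ξ ht0

lemma integral_tail {s R : ℝ} (hs : s < 1) (hR : 0 < R) (a : ℝ) :
    ∫ t in Set.Ioi R, a * t ^ (2 * s - 3) = a * (R ^ (2 * s - 2) / (2 - 2 * s)) := by
  rw [integral_const_mul, integral_Ioi_rpow_of_lt (by linarith) hR,
    show 2 * s - 3 + 1 = 2 * s - 2 by ring, ← neg_sub 2 (2 * s), div_neg, neg_div, neg_neg]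

lemma setIntegral_Ioc_weight_le {s κ ξ R : ℝ} (hs : 0 < s) (hκ : 0 < κ) (hκR : κ ≤ R)
    (hR : R ^ 2 = κ ^ 2 + ξ ^ 2)
    (hf : IntegrableOn (fun t : ℝ => t ^ (2 * s - 1) * ξ ^ 2 / (4 * t ^ 2 + ξ ^ 2))
      (Set.Ioc κ R)) :
    ∫ t in Set.Ioc κ R, t ^ (2 * s - 1) * ξ ^ 2 / (4 * t ^ 2 + ξ ^ 2) ≤
      ξ ^ 2 * (R ^ (2 * s - 2) / (2 * s)) := by
  have hR0 : 0 < R := hκ.trans_le hκR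
  have hI : IntegrableOn (fun t : ℝ => ξ ^ 2 / R ^ 2 * t ^ (2 * s - 1)) (Set.Ioc κ R) :=
    ((intervalIntegrable_iff_integrableOn_Ioc_of_le hκR).1
      (intervalIntegral.intervalIntegrable_rpow' (by linarith))).const_mul _
  calc ∫ t in Set.Ioc κ R, t ^ (2 * s - 1) * ξ ^ 2 / (4 * t ^ 2 + ξ ^ 2)
      ≤ ∫ t in Set.Ioc κ R, ξ ^ 2 / R ^ 2 * t ^ (2 * s - 1) := by
        refine setIntegral_mono_on hf hI measurableSet_Ioc fun t ht => ?_
        have ht0 : 0 < t := hκ.trans ht.1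
        have h := Real.rpow_nonneg ht0.le (2 * s - 1)
        calc t ^ (2 * s - 1) * ξ ^ 2 / (4 * t ^ 2 + ξ ^ 2)
            ≤ t ^ (2 * s - 1) * ξ ^ 2 / R ^ 2 := by
              gcongr
              nlinarith [ht.1]
          _ = _ := by ring
    _ = ξ ^ 2 / R ^ 2 * ((R ^ (2 * s) - κ ^ (2 * s)) / (2 * s)) := by
        rw [integral_const_mul, ← intervalIntegral.integral_of_le hκR,
          integral_rpow (Or.inl (by linarith)), sub_add_cancel]
    _ ≤ ξ ^ 2 / R ^ 2 * (R ^ (2 * s) / (2 * s)) := by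
        have := Real.rpow_nonneg hκ.le (2 * s)
        gcongr
        linarith
    _ = ξ ^ 2 * (R ^ (2 * s - 2) / (2 * s)) := by
        rw [Real.rpow_sub hR0, Real.rpow_two]
        ring

/-- The comparison, from Section 4 of the paper, of the quadratic part of the
renormalized conserved quantity with the `H^s` weight:
`∫_κ^∞ ϰ^{2s−1} ξ²/(4ϰ²+ξ²) dϰ ≈_s ξ²(κ²+ξ²)^{s−1}`. -/
theorem beta_s_weight_comparison (s : ℝ) (hs : 0 < s) (hs' : s < 1 / 2) :
    ∃ c C : ℝ, 0 < c ∧ 0 < C ∧ ∀ κ : ℝ, 0 < κ → ∀ ξ : ℝ,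
      c * ξ ^ 2 * (κ ^ 2 + ξ ^ 2) ^ (s - 1) ≤
        (∫ t in Set.Ioi κ, t ^ (2 * s - 1) * ξ ^ 2 / (4 * t ^ 2 + ξ ^ 2)) ∧
      (∫ t in Set.Ioi κ, t ^ (2 * s - 1) * ξ ^ 2 / (4 * t ^ 2 + ξ ^ 2)) ≤
        C * ξ ^ 2 * (κ ^ 2 + ξ ^ 2) ^ (s - 1) := by
  refine ⟨1 / (5 * (2 - 2 * s)), 1 / (2 * s) + 1 / (4 * (2 - 2 * s)), ?_, ?_, fun κ hκ ξ => ?_⟩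
  · have : 0 < 2 - 2 * s := by linarith
    positivity
  · have : 0 < 2 - 2 * s := by linarith
    positivity
  obtain ⟨R, hRdef⟩ : ∃ R, R = √(κ ^ 2 + ξ ^ 2) := ⟨_, rfl⟩
  have hR : R ^ 2 = κ ^ 2 + ξ ^ 2 := by rw [hRdef, Real.sq_sqrt (by positivity)]
  have hR0 : 0 < R := by rw [hRdef]; positivity
  have hκR : κ ≤ R := by nlinarith [sq_nonneg ξ]
  have hpow : (κ ^ 2 + ξ ^ 2) ^ (s - 1) = R ^ (2 * s - 2) := by
    rw [← hR, ← Real.rpow_two, ← Real.rpow_mul hR0.le]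
    ring_nf
  have hs1 : s < 1 := by linarith
  have hf := integrableOn_weight hs1 ξ hκ
  have hfR := integrableOn_weight hs1 ξ hR0
  have hfI := hf.mono_set (Set.Ioc_subset_Ioi_self (a := R) (b := κ))
  have htail (a : ℝ) : IntegrableOn (fun t : ℝ => a * t ^ (2 * s - 3)) (Set.Ioi R) :=
    (integrableOn_Ioi_rpow_of_lt (by linarith) hR0).const_mul _
  have hlow := setIntegral_mono_on (htail (ξ ^ 2 / 5)) hfR measurableSet_Ioi fun t ht =>
    tail_le_weight s ξ (hR0.trans ht) (by
      have ht' : R < t := ht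
      nlinarith [sq_nonneg κ])
  have hup := setIntegral_mono_on hfR (htail (ξ ^ 2 / 4)) measurableSet_Ioi fun t ht =>
    weight_le_tail s ξ (hR0.trans ht)
  rw [integral_tail hs1 hR0] at hlow hup
  have hmid := setIntegral_Ioc_weight_le hs hκ hκR hR hfI
  have hnonneg : 0 ≤ ∫ t in Set.Ioc κ R, t ^ (2 * s - 1) * ξ ^ 2 / (4 * t ^ 2 + ξ ^ 2) :=
    setIntegral_nonneg measurableSet_Ioc fun t ht => by
      have h := Real.rpow_nonneg (hκ.trans ht.1).le (2 * s - 1)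
      positivity
  rw [← Set.Ioc_union_Ioi_eq_Ioi hκR, setIntegral_union (Set.Ioc_disjoint_Ioi le_rfl)
    measurableSet_Ioi hfI hfR, hpow]
  constructor
  · calc _ = ξ ^ 2 / 5 * (R ^ (2 * s - 2) / (2 - 2 * s)) := by
          rw [one_div, mul_inv]; ring
      _ ≤ _ := by linarith
  · calc _ ≤ ξ ^ 2 * (R ^ (2 * s - 2) / (2 * s)) + ξ ^ 2 / 4 * (R ^ (2 * s - 2) / (2 - 2 * s)) := by
          linarith
      _ = _ := by
          rw [one_div, one_div, mul_inv 4]; ring
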